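/- Define ℓ̇₁ := (1/√N) Σ_{j=2}^N g_{1j} σ̇_j, a function of the disorder g and the configuration σ. Then for every integer k ≥ 1 there is a constant C(β,k) depending only on β and k (and not on N) such that E ⟨ℓ̇₁ᵏ⟩ ≤ C(β,k). -/

import Mathlib

open MeasureTheory ProbabilityTheory Real Finset

namespace SK

/-- Index set of pairs `i < j` in `Fin N`. -/
abbrev Pairs (N : ℕ) := {p : Fin N × Fin N // p.1 < p.2}

/-- The disorder: one real coordinate per pair. -/
abbrev Disorder (N : ℕ) := Pairs N → ℝ

/-- Law of the disorder: i.i.d. standard Gaussians. -/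
noncomputable def μdis (N : ℕ) : Measure (Disorder N) :=
  Measure.pi fun _ => gaussianReal 0 1

/-- The symmetric extension `g_{ij}` of the disorder. -/
noncomputable def gval {N : ℕ} (G : Disorder N) (i j : Fin N) : ℝ :=
  if hij : i < j then G ⟨(i, j), hij⟩ else if hji : j < i then G ⟨(j, i), hji⟩ else 0

abbrev Config (N : ℕ) := Fin N → Bool

/-- Spins `±1`. -/
def spin (b : Bool) : ℝ := if b then 1 else -1

/-- (Negative) Hamiltonian of the SK model. -/
noncomputable def ham {N : ℕ} (β h : ℝ) (G : Disorder N) (σ : Config N) : ℝ :=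
  (β / Real.sqrt N) * ∑ p : Pairs N, G p * spin (σ p.1.1) * spin (σ p.1.2)
    + h * ∑ i, spin (σ i)

/-- Partition function. -/
noncomputable def Zpart {N : ℕ} (β h : ℝ) (G : Disorder N) : ℝ :=
  ∑ σ : Config N, Real.exp (ham β h G σ)

/-- Gibbs measure. -/
noncomputable def gibbs {N : ℕ} (β h : ℝ) (G : Disorder N) (σ : Config N) : ℝ :=
  Real.exp (ham β h G σ) / Zpart β h G

/-- Quenched average of a function of one replica. -/
noncomputable def qavg {N : ℕ} (β h : ℝ) (G : Disorder N) (f : Config N → ℝ) : ℝ :=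
  ∑ σ : Config N, f σ * gibbs β h G σ

/-- Quenched average of a function of two replicas. -/
noncomputable def qavg2 {N : ℕ} (β h : ℝ) (G : Disorder N)
    (f : Config N → Config N → ℝ) : ℝ :=
  ∑ σ1 : Config N, ∑ σ2 : Config N, f σ1 σ2 * gibbs β h G σ1 * gibbs β h G σ2

/-- Overlap of two configurations. -/
noncomputable def overlap {N : ℕ} (σ1 σ2 : Config N) : ℝ :=
  (1 / (N : ℝ)) * ∑ i, spin (σ1 i) * spin (σ2 i)

/-- The high temperature condition `E⟨(R₁₂ - q)⁴⟩ ≤ K/N²`. -/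
def highTemp (N : ℕ) (β h q K : ℝ) : Prop :=
  ∫ G, qavg2 β h G (fun σ1 σ2 => (overlap σ1 σ2 - q) ^ 4) ∂(μdis N) ≤ K / (N : ℝ) ^ 2

/-- Magnetization `⟨σ_i⟩`. -/
noncomputable def mavg {N : ℕ} (β h : ℝ) (G : Disorder N) (i : Fin N) : ℝ :=
  qavg β h G fun σ => spin (σ i)

/-- Local field `ℓ_i`. -/
noncomputable def locField {N : ℕ} (G : Disorder N) (i : Fin N) (σ : Config N) : ℝ :=
  (1 / Real.sqrt N) * ∑ j ∈ Finset.univ.erase i, gval G i j * spin (σ j)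

/-- The field `r_i`. -/
noncomputable def rfield {N : ℕ} (β h q : ℝ) (G : Disorder N) (i : Fin N) : ℝ :=
  (1 / Real.sqrt N) * ∑ j ∈ Finset.univ.erase i, gval G i j * mavg β h G j
    - β * (1 - q) * mavg β h G i

/-- Gaussian density `φ_{μ,v}` with mean `μ` and variance `v`. -/
noncomputable def gaussDens (μ v x : ℝ) : ℝ :=
  (1 / (Real.sqrt (2 * π) * Real.sqrt v)) * Real.exp (-(x - μ) ^ 2 / (2 * v))

/-- Mixture-Gaussian density `ψ_{a,b,μ,v}`. -/
noncomputable def mixDens (a b μ v x : ℝ) : ℝ :=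
  Real.cosh (a * x + b) * Real.exp (-(x - μ) ^ 2 / (2 * v)) /
    (Real.sqrt (2 * π) * Real.sqrt v * Real.cosh (a * μ + b) * Real.exp (a ^ 2 * v / 2))


section WeightedAverage

variable {ι : Type*} [Fintype ι] {w : ι → ℝ}

theorem exp_weighted_sum_le (hw : ∀ i, 0 ≤ w i) (hw1 : ∑ i, w i = 1) (f : ι → ℝ) :
    Real.exp (∑ i, w i * f i) ≤ ∑ i, w i * Real.exp (f i) := by
  simpa using convexOn_exp.map_sum_le (t := Finset.univ) (w := w) (p := f)
    (fun i _ => hw i) hw1 (fun i _ => Set.mem_univ _)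

theorem sq_weighted_sum_exp_le (hw : ∀ i, 0 ≤ w i) (hw1 : ∑ i, w i = 1) (f : ι → ℝ) :
    (∑ i, w i * Real.exp (f i)) ^ 2 ≤ ∑ i, w i * Real.exp (2 * f i) := by
  refine (Real.pow_arith_mean_le_arith_mean_pow Finset.univ w (fun i => Real.exp (f i))
    (fun i _ => hw i) hw1 (fun i _ => (Real.exp_pos _).le) 2).trans_eq ?_
  refine Finset.sum_congr rfl fun i _ => ?_
  rw [← Real.exp_nat_mul]
  norm_num

/-- Tilting a probability weight by `exp d` with `|d| ≤ a` costs at most two factors `exp a`. -/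
theorem tilted_average_le (hw : ∀ i, 0 ≤ w i) (hw1 : ∑ i, w i = 1) {F d a : ι → ℝ}
    (hF : ∀ i, 0 ≤ F i) (hd : ∀ i, |d i| ≤ a i) :
    (∑ i, w i * (F i * Real.exp (d i))) / ∑ i, w i * Real.exp (d i)
      ≤ (∑ i, w i * (F i * Real.exp (a i))) * ∑ i, w i * Real.exp (a i) := by
  have hden : 0 < ∑ i, w i * Real.exp (d i) :=
    (Real.exp_pos _).trans_le (exp_weighted_sum_le hw hw1 d)
  have hnum : ∑ i, w i * (F i * Real.exp (d i)) ≤ ∑ i, w i * (F i * Real.exp (a i)) :=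
    Finset.sum_le_sum fun i _ => mul_le_mul_of_nonneg_left (mul_le_mul_of_nonneg_left
      (Real.exp_le_exp.2 ((le_abs_self _).trans (hd i))) (hF i)) (hw i)
  have hone : 1 ≤ (∑ i, w i * Real.exp (a i)) * ∑ i, w i * Real.exp (d i) := by
    have hpos := exp_weighted_sum_le hw hw1 a
    have hneg := exp_weighted_sum_le hw hw1 d
    have hsum : 0 ≤ (∑ i, w i * a i) + ∑ i, w i * d i := by
      rw [← Finset.sum_add_distrib]
      refine Finset.sum_nonneg fun i _ => ?_
      rw [← mul_add]
      exact mul_nonneg (hw i) (by linarith [neg_abs_le (d i), hd i])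
    calc (1 : ℝ) ≤ Real.exp (∑ i, w i * a i) * Real.exp (∑ i, w i * d i) := by
          rw [← Real.exp_add]; exact Real.one_le_exp hsum
      _ ≤ _ := mul_le_mul hpos hneg (Real.exp_pos _).le ((Real.exp_pos _).le.trans hpos)
  have hnn : 0 ≤ ∑ i, w i * (F i * Real.exp (a i)) :=
    Finset.sum_nonneg fun i _ => mul_nonneg (hw i) (mul_nonneg (hF i) (Real.exp_pos _).le)
  rw [div_le_iff₀ hden, mul_assoc]
  exact hnum.trans (le_mul_of_one_le_right hnn hone)

/-- Centred moments are controlled by exponential moments of twice the size. -/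
theorem centered_moment_le (hw : ∀ i, 0 ≤ w i) (hw1 : ∑ i, w i = 1) (f : ι → ℝ) (k : ℕ) :
    |∑ i, (f i - ∑ j, w j * f j) ^ k * w i|
      ≤ (k.factorial : ℝ) * ∑ i, w i * Real.exp (2 * |f i|) := by
  have hmean : Real.exp |∑ j, w j * f j| ≤ ∑ j, w j * Real.exp |f j| := by
    refine le_trans (Real.exp_le_exp.2 ?_) (exp_weighted_sum_le hw hw1 fun j => |f j|)
    refine (Finset.abs_sum_le_sum_abs _ _).trans_eq ?_
    simp only [abs_mul, abs_of_nonneg (hw _)]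
  have hpt : ∀ i, |(f i - ∑ j, w j * f j) ^ k * w i|
      ≤ k.factorial * (∑ j, w j * Real.exp |f j|) * (w i * Real.exp |f i|) := by
    intro i
    rw [abs_mul, abs_pow, abs_of_nonneg (hw i)]
    have hexp := Real.pow_div_factorial_le_exp _ (abs_nonneg (f i - ∑ j, w j * f j)) k
    rw [div_le_iff₀ (by positivity)] at hexp
    have hsplit : Real.exp |f i - ∑ j, w j * f j|
        ≤ Real.exp |f i| * ∑ j, w j * Real.exp |f j| := by
      refine (Real.exp_le_exp.2 (abs_sub _ _)).trans ?_
      rw [Real.exp_add]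
      gcongr
    calc |f i - ∑ j, w j * f j| ^ k * w i
        ≤ (Real.exp |f i| * ∑ j, w j * Real.exp |f j|) * k.factorial * w i := by
          refine mul_le_mul_of_nonneg_right (hexp.trans ?_) (hw i)
          gcongr
      _ = _ := by ring
  calc |∑ i, (f i - ∑ j, w j * f j) ^ k * w i|
      ≤ ∑ i, |(f i - ∑ j, w j * f j) ^ k * w i| := Finset.abs_sum_le_sum_abs _ _
    _ ≤ ∑ i, k.factorial * (∑ j, w j * Real.exp |f j|) * (w i * Real.exp |f i|) :=
        Finset.sum_le_sum fun i _ => hpt i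
    _ = k.factorial * (∑ i, w i * Real.exp |f i|) ^ 2 := by rw [← Finset.mul_sum]; ring
    _ ≤ _ := by
        gcongr
        exact sq_weighted_sum_exp_le hw hw1 fun i => |f i|

end WeightedAverage

theorem Zpart_pos {N : ℕ} (β h : ℝ) (G : Disorder N) : 0 < Zpart β h G :=
  Finset.sum_pos (fun _ _ => Real.exp_pos _) Finset.univ_nonempty

theorem gibbs_nonneg {N : ℕ} (β h : ℝ) (G : Disorder N) (σ : Config N) : 0 ≤ gibbs β h G σ :=
  div_nonneg (Real.exp_pos _).le (Zpart_pos β h G).le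

theorem sum_gibbs {N : ℕ} (β h : ℝ) (G : Disorder N) : ∑ σ, gibbs β h G σ = 1 := by
  simp only [gibbs, ← Finset.sum_div]
  exact div_self (Zpart_pos β h G).ne'

theorem gibbs_le_one {N : ℕ} (β h : ℝ) (G : Disorder N) (σ : Config N) : gibbs β h G σ ≤ 1 :=
  (Finset.single_le_sum (fun τ _ => gibbs_nonneg β h G τ) (Finset.mem_univ σ)).trans_eq
    (sum_gibbs β h G)

theorem measurable_gibbs {N : ℕ} (β h : ℝ) (σ : Config N) :
    Measurable fun G : Disorder N => gibbs β h G σ := by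
  unfold gibbs Zpart ham
  fun_prop

theorem abs_spin (b : Bool) : |spin b| = 1 := by
  cases b <;> simp [spin]

/-- The disorder with the couplings `g_{ij}`, `j > i`, set to zero. -/
noncomputable def offRow {N : ℕ} (i : Fin N) (G : Disorder N) : Disorder N :=
  fun p => if p.1.1 = i then 0 else G p

/-- Coefficients of `ℓ_i` in the disorder, when `i` is the least index. -/
noncomputable def rowCoeff {N : ℕ} (i : Fin N) (σ : Config N) (p : Pairs N) : ℝ :=
  if p.1.1 = i then spin (σ p.1.2) / Real.sqrt N else 0

theorem sum_row {N : ℕ} {i : Fin N} (hi : ∀ j, i ≤ j) (f : Pairs N → ℝ) :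
    ∑ p : Pairs N, (if p.1.1 = i then f p else 0)
      = ∑ j ∈ Finset.univ.erase i, if hij : i < j then f ⟨(i, j), hij⟩ else 0 := by
  rw [← Finset.sum_filter]
  symm
  refine Finset.sum_bij'
    (fun j hj => ⟨(i, j), lt_of_le_of_ne (hi j) (Finset.ne_of_mem_erase hj).symm⟩)
    (fun p _ => p.1.2) ?_ ?_ ?_ ?_ ?_
  · intro j hj
    simp
  · rintro ⟨⟨a, b⟩, hab⟩ hp
    simp only [Finset.mem_filter, Finset.mem_univ, true_and] at hp
    subst hp
    simpa using hab.ne'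
  · intro j hj
    rfl
  · rintro ⟨⟨a, b⟩, hab⟩ hp
    simp only [Finset.mem_filter, Finset.mem_univ, true_and] at hp
    subst hp
    rfl
  · intro j hj
    rw [dif_pos]

theorem locField_eq_sum {N : ℕ} {i : Fin N} (hi : ∀ j, i ≤ j) (G : Disorder N) (σ : Config N) :
    locField G i σ = ∑ p, rowCoeff i σ p * G p := by
  simp only [rowCoeff, ite_mul, zero_mul]
  rw [sum_row hi fun p => spin (σ p.1.2) / Real.sqrt N * G p, locField, Finset.mul_sum]
  refine Finset.sum_congr rfl fun j hj => ?_
  have hij : i < j := lt_of_le_of_ne (hi j) (Finset.ne_of_mem_erase hj).symm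
  rw [gval, dif_pos hij, dif_pos hij]
  ring

theorem sum_rowCoeff_sq_le {N : ℕ} {i : Fin N} (hi : ∀ j, i ≤ j) (σ : Config N) :
    ∑ p, rowCoeff i σ p ^ 2 ≤ 1 := by
  have hN : (0 : ℝ) < N := by exact_mod_cast i.pos
  have hsq : ∀ p, rowCoeff i σ p ^ 2 = if p.1.1 = i then (1 / N : ℝ) else 0 := by
    intro p
    unfold rowCoeff
    split_ifs
    · rw [div_pow, ← sq_abs, abs_spin, Real.sq_sqrt hN.le, one_pow]
    · simp
  simp only [hsq]
  rw [sum_row hi fun _ => (1 / N : ℝ)]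
  calc _ ≤ ∑ _j : Fin N, (1 / N : ℝ) := by
        refine (Finset.sum_le_sum fun j _ => ?_).trans
          (Finset.sum_le_sum_of_subset_of_nonneg (Finset.erase_subset i _)
            fun _ _ _ => by positivity)
        split_ifs
        · exact le_rfl
        · positivity
    _ = 1 := by simp [hN.ne']

theorem ham_eq_offRow_add {N : ℕ} {i : Fin N} (hi : ∀ j, i ≤ j) (β h : ℝ) (G : Disorder N)
    (σ : Config N) :
    ham β h G σ = ham β h (offRow i G) σ + β * spin (σ i) * locField G i σ := by
  rw [locField_eq_sum hi]
  simp only [ham, Finset.mul_sum]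
  rw [add_right_comm, ← Finset.sum_add_distrib]
  congr 1
  refine Finset.sum_congr rfl fun p _ => ?_
  simp only [offRow, rowCoeff]
  split_ifs with hp
  · rw [hp]; ring
  · ring

theorem gibbs_average_eq {N : ℕ} {i : Fin N} (hi : ∀ j, i ≤ j) (β h : ℝ) (G : Disorder N)
    (F : Config N → ℝ) :
    ∑ σ, gibbs β h G σ * F σ
      = (∑ σ, gibbs β h (offRow i G) σ * (F σ * Real.exp (β * spin (σ i) * locField G i σ)))
        / ∑ σ, gibbs β h (offRow i G) σ * Real.exp (β * spin (σ i) * locField G i σ) := by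
  have hZ : ∑ σ, gibbs β h (offRow i G) σ * Real.exp (β * spin (σ i) * locField G i σ)
      = Zpart β h G / Zpart β h (offRow i G) := by
    rw [Zpart, Finset.sum_div]
    refine Finset.sum_congr rfl fun σ _ => ?_
    rw [ham_eq_offRow_add hi, Real.exp_add, gibbs]
    ring
  rw [hZ, Finset.sum_div]
  refine Finset.sum_congr rfl fun σ _ => ?_
  have h1 := (Zpart_pos β h G).ne'
  have h2 := (Zpart_pos β h (offRow i G)).ne'
  rw [gibbs, gibbs, ham_eq_offRow_add hi, Real.exp_add]
  field_simp

/-- Cavity bound: exponential moments of `ℓ_i` under the Gibbs measure are controlled by those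
under the Gibbs measure that ignores the couplings of `i`. -/
theorem gibbs_exp_locField_le {N : ℕ} {i : Fin N} (hi : ∀ j, i ≤ j) {β : ℝ} (hβ : 0 < β) (h : ℝ)
    (G : Disorder N) :
    ∑ σ, gibbs β h G σ * Real.exp (2 * |locField G i σ|)
      ≤ ∑ σ, gibbs β h (offRow i G) σ * Real.exp (2 * (2 + β) * |locField G i σ|) := by
  have hw := gibbs_nonneg β h (offRow i G)
  have hw1 := sum_gibbs β h (offRow i G)
  rw [gibbs_average_eq hi]
  refine (tilted_average_le hw hw1 (a := fun σ => β * |locField G i σ|)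
    (fun σ => (Real.exp_pos _).le) fun σ => ?_).trans ?_
  · rw [abs_mul, abs_mul, abs_spin, abs_of_pos hβ, mul_one]
  · simp only [← Real.exp_add, ← add_mul]
    have hnn : 0 ≤ ∑ σ, gibbs β h (offRow i G) σ * Real.exp ((2 + β) * |locField G i σ|) :=
      Finset.sum_nonneg fun σ _ => mul_nonneg (hw σ) (Real.exp_pos _).le
    calc _ ≤ (∑ σ, gibbs β h (offRow i G) σ * Real.exp ((2 + β) * |locField G i σ|)) ^ 2 := by
          rw [sq]
          refine mul_le_mul_of_nonneg_left (Finset.sum_le_sum fun σ _ => ?_) hnn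
          refine mul_le_mul_of_nonneg_left (Real.exp_le_exp.2 ?_) (hw σ)
          nlinarith [abs_nonneg (locField G i σ)]
      _ ≤ _ := by
          refine (sq_weighted_sum_exp_le hw hw1 _).trans_eq ?_
          simp only [mul_assoc]

theorem exp_sum_mul_eq_prod {ι : Type*} [Fintype ι] (a x : ι → ℝ) (t : ℝ) :
    Real.exp (t * ∑ p, a p * x p) = ∏ p, Real.exp (t * a p * x p) := by
  rw [Finset.mul_sum, Real.exp_sum]
  simp only [mul_assoc]

theorem integrable_exp_locField {N : ℕ} {i : Fin N} (hi : ∀ j, i ≤ j) (σ : Config N) (t : ℝ) :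
    Integrable (fun G => Real.exp (t * locField G i σ)) (μdis N) := by
  simp only [locField_eq_sum hi, exp_sum_mul_eq_prod]
  exact Integrable.fintype_prod (f := fun p x => Real.exp (t * rowCoeff i σ p * x))
    fun p => integrable_exp_mul_gaussianReal _

theorem integral_exp_locField_le {N : ℕ} {i : Fin N} (hi : ∀ j, i ≤ j) (σ : Config N) (t : ℝ) :
    ∫ G, Real.exp (t * locField G i σ) ∂(μdis N) ≤ Real.exp (t ^ 2 / 2) := by
  simp only [locField_eq_sum hi, exp_sum_mul_eq_prod]
  have hmgf : ∀ s : ℝ, ∫ x, Real.exp (s * x) ∂(gaussianReal 0 1) = Real.exp (s ^ 2 / 2) := by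
    intro s
    simpa [mgf] using congrFun (mgf_id_gaussianReal (μ := 0) (v := 1)) s
  rw [μdis, integral_fintype_prod_eq_prod (fun p x => Real.exp (t * rowCoeff i σ p * x))]
  simp only [hmgf, ← Real.exp_sum]
  refine Real.exp_le_exp.2 ?_
  calc ∑ p, (t * rowCoeff i σ p) ^ 2 / 2 = t ^ 2 / 2 * ∑ p, rowCoeff i σ p ^ 2 := by
        rw [Finset.mul_sum]
        exact Finset.sum_congr rfl fun p _ => by ring
    _ ≤ _ := mul_le_of_le_one_right (by positivity) (sum_rowCoeff_sq_le hi σ)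

theorem indepFun_gibbs_offRow_exp_locField {N : ℕ} {i : Fin N} (hi : ∀ j, i ≤ j) (β h : ℝ)
    (σ : Config N) (t : ℝ) :
    IndepFun (fun G => gibbs β h (offRow i G) σ) (fun G => Real.exp (t * locField G i σ))
      (μdis N) := by
  let S : Finset (Pairs N) := Finset.univ.filter fun p => p.1.1 ≠ i
  let T : Finset (Pairs N) := Finset.univ.filter fun p => p.1.1 = i
  have hST : Disjoint S T := (Finset.disjoint_filter_filter_not _ _ _).symm
  have hind : iIndepFun (fun (p : Pairs N) (G : Disorder N) => G p) (μdis N) :=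
    iIndepFun_pi (X := fun _ x => x) fun _ => aemeasurable_id
  have hsplit := hind.indepFun_finset S T hST fun p => measurable_pi_apply p
  let φ : (S → ℝ) → ℝ := fun x => gibbs β h (fun p => if hp : p ∈ S then x ⟨p, hp⟩ else 0) σ
  let ψ : (T → ℝ) → ℝ := fun x => Real.exp (t * ∑ p : T, rowCoeff i σ p * x p)
  have hφ : Measurable φ := by
    refine (measurable_gibbs β h σ).comp (measurable_pi_lambda _ fun p => ?_)
    split_ifs <;> fun_prop
  have hψ : Measurable ψ := by fun_prop
  convert hsplit.comp hφ hψ using 1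
  · funext G
    simp only [Function.comp_apply, φ]
    congr 1
    funext p
    by_cases hp : p.1.1 = i <;> simp [offRow, S, hp]
  · funext G
    simp only [Function.comp_apply, ψ, locField_eq_sum hi]
    congr 2
    rw [Finset.sum_coe_sort T fun p => rowCoeff i σ p * G p, Finset.sum_filter]
    refine Finset.sum_congr rfl fun p _ => ?_
    by_cases hp : p.1.1 = i <;> simp [rowCoeff, hp]

theorem measurable_gibbs_offRow {N : ℕ} (i : Fin N) (β h : ℝ) (σ : Config N) :
    Measurable fun G : Disorder N => gibbs β h (offRow i G) σ := by
  refine (measurable_gibbs β h σ).comp (measurable_pi_lambda _ fun p => ?_)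
  unfold offRow
  split_ifs <;> fun_prop

theorem integrable_gibbs_offRow {N : ℕ} (i : Fin N) (β h : ℝ) (σ : Config N) :
    Integrable (fun G => gibbs β h (offRow i G) σ) (μdis N) := by
  have : IsProbabilityMeasure (μdis N) := by unfold μdis; infer_instance
  refine (integrable_const (1 : ℝ)).mono' (measurable_gibbs_offRow i β h σ).aestronglyMeasurable
    (Filter.Eventually.of_forall fun G => ?_)
  rw [Real.norm_of_nonneg (gibbs_nonneg _ _ _ _)]
  exact gibbs_le_one _ _ _ _

theorem integrable_offRow_average {N : ℕ} {i : Fin N} (hi : ∀ j, i ≤ j) (β h t : ℝ) :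
    Integrable (fun G => ∑ σ, gibbs β h (offRow i G) σ * Real.exp (t * locField G i σ))
      (μdis N) :=
  integrable_finsetSum _ fun σ _ => (indepFun_gibbs_offRow_exp_locField hi β h σ t).integrable_mul
    (integrable_gibbs_offRow i β h σ) (integrable_exp_locField hi σ t)

theorem integral_offRow_average_le {N : ℕ} {i : Fin N} (hi : ∀ j, i ≤ j) (β h t : ℝ) :
    ∫ G, ∑ σ, gibbs β h (offRow i G) σ * Real.exp (t * locField G i σ) ∂(μdis N)
      ≤ Real.exp (t ^ 2 / 2) := by
  have : IsProbabilityMeasure (μdis N) := by unfold μdis; infer_instance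
  have hind := fun σ => indepFun_gibbs_offRow_exp_locField hi β h σ t
  have hg := integrable_gibbs_offRow i β h
  have he := fun σ => integrable_exp_locField hi σ t
  have hint : ∀ σ, Integrable
      (fun G => gibbs β h (offRow i G) σ * Real.exp (t * locField G i σ)) (μdis N) :=
    fun σ => (hind σ).integrable_mul (hg σ) (he σ)
  rw [integral_finsetSum _ fun σ _ => hint σ]
  calc _ = ∑ σ, (∫ G, gibbs β h (offRow i G) σ ∂(μdis N))
        * ∫ G, Real.exp (t * locField G i σ) ∂(μdis N) :=
        Finset.sum_congr rfl fun σ _ => (hind σ).integral_fun_mul_eq_mul_integral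
          (hg σ).aestronglyMeasurable (he σ).aestronglyMeasurable
    _ ≤ ∑ σ, (∫ G, gibbs β h (offRow i G) σ ∂(μdis N)) * Real.exp (t ^ 2 / 2) :=
        Finset.sum_le_sum fun σ _ => mul_le_mul_of_nonneg_left (integral_exp_locField_le hi σ t)
          (integral_nonneg fun G => gibbs_nonneg _ _ _ _)
    _ = Real.exp (t ^ 2 / 2) := by
        rw [← Finset.sum_mul, ← integral_finsetSum _ fun σ _ => hg σ]
        simp [sum_gibbs]

theorem sum_gibbs_mul_locField {N : ℕ} (β h : ℝ) (G : Disorder N) (i : Fin N) :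
    ∑ σ, gibbs β h G σ * locField G i σ
      = (1 / Real.sqrt N) * ∑ j ∈ Finset.univ.erase i, gval G i j * mavg β h G j := by
  simp only [locField, mavg, qavg, Finset.mul_sum]
  rw [Finset.sum_comm]
  refine Finset.sum_congr rfl fun j _ => Finset.sum_congr rfl fun σ _ => ?_
  ring

theorem centered_field_eq {N : ℕ} (β h : ℝ) (G : Disorder N) (i : Fin N) (σ : Config N) :
    (1 / Real.sqrt N) * ∑ j ∈ Finset.univ.erase i, gval G i j * (spin (σ j) - mavg β h G j)
      = locField G i σ - ∑ τ, gibbs β h G τ * locField G i τ := by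
  rw [sum_gibbs_mul_locField, locField, ← mul_sub, ← Finset.sum_sub_distrib]
  simp only [mul_sub]

theorem exp_mul_abs_le {t : ℝ} (x : ℝ) :
    Real.exp (t * |x|) ≤ Real.exp (t * x) + Real.exp (-t * x) := by
  rcases abs_cases x with ⟨hx, -⟩ | ⟨hx, -⟩ <;> rw [hx]
  · linarith [Real.exp_pos (-t * x)]
  · rw [mul_neg, ← neg_mul]
    linarith [Real.exp_pos (t * x)]

/-- Estimate (3.15): `E⟨ℓ̇₁ᵏ⟩ ≤ C(β,k)`, uniformly in `N`. -/
theorem ldot_moment_bound (β : ℝ) (hβ : 0 < β) (k : ℕ) (hk : 1 ≤ k) :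
    ∃ C : ℝ, 0 < C ∧ ∀ (N : ℕ) (hN : 2 ≤ N) (h : ℝ),
      ∫ G, qavg β h G (fun σ =>
          ((1 / Real.sqrt N) * ∑ j ∈ Finset.univ.erase (⟨0, by omega⟩ : Fin N),
            gval G (⟨0, by omega⟩ : Fin N) j
              * (spin (σ j) - mavg β h G j)) ^ k) ∂(μdis N)
      ≤ C := by
  refine ⟨k.factorial * (2 * Real.exp ((2 * (2 + β)) ^ 2 / 2)), by positivity, fun N hN h => ?_⟩
  have hi : ∀ j : Fin N, (⟨0, by omega⟩ : Fin N) ≤ j := fun j => Nat.zero_le _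
  generalize (⟨0, by omega⟩ : Fin N) = i at hi ⊢
  simp only [centered_field_eq, qavg]
  set t : ℝ := 2 * (2 + β)
  have hint := integrable_offRow_average hi β h
  have hbound : ∀ G : Disorder N,
      ‖∑ σ, (locField G i σ - ∑ τ, gibbs β h G τ * locField G i τ) ^ k * gibbs β h G σ‖
        ≤ k.factorial * (∑ σ, gibbs β h (offRow i G) σ * Real.exp (t * locField G i σ)
          + ∑ σ, gibbs β h (offRow i G) σ * Real.exp (-t * locField G i σ)) := by
    intro G
    refine (centered_moment_le (gibbs_nonneg β h G) (sum_gibbs β h G) _ k).trans ?_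
    refine mul_le_mul_of_nonneg_left ((gibbs_exp_locField_le hi hβ h G).trans ?_) (by positivity)
    rw [← Finset.sum_add_distrib]
    refine Finset.sum_le_sum fun σ _ => ?_
    rw [← mul_add]
    exact mul_le_mul_of_nonneg_left (exp_mul_abs_le _) (gibbs_nonneg _ _ _ _)
  refine (Real.le_norm_self _).trans ((norm_integral_le_of_norm_le
    (((hint t).add (hint (-t))).const_mul _) (Filter.Eventually.of_forall hbound)).trans ?_)
  rw [integral_const_mul]
  refine mul_le_mul_of_nonneg_left ?_ (by positivity)
  refine (integral_add (hint t) (hint (-t))).trans_le ?_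
  have h1 := integral_offRow_average_le hi β h t
  have h2 := integral_offRow_average_le hi β h (-t)
  rw [neg_sq] at h2
  linarith

end SK
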